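/- Let Γ = {(√5)^n : n ∈ ℤ} ⊆ ℝ. There is no additive subgroup E of ℝ containing ℤ such that IM_+(E) = Γ. -/

import Mathlib

/-- The positive inner multiplier group of an additive subgroup `E` of `ℝ`:
`IM₊(E) = {t > 0 | t ∈ E, t⁻¹ ∈ E, tE = E}`. -/
def IMplus (E : AddSubgroup ℝ) : Set ℝ :=
  {t : ℝ | 0 < t ∧ t ∈ E ∧ t⁻¹ ∈ E ∧ (fun x => t * x) '' (E : Set ℝ) = (E : Set ℝ)}

/-- the group `Γ = {(√5)ⁿ : n ∈ ℤ}` does not arise as `IM₊(E)` for any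
additive subgroup `E` of `ℝ` containing `ℤ`. -/
theorem no_addSubgroup_IMplus_eq_sqrt5_powers :
    ¬ ∃ E : AddSubgroup ℝ, (∀ n : ℤ, (n : ℝ) ∈ E) ∧
      IMplus E = {x : ℝ | ∃ n : ℤ, x = Real.sqrt 5 ^ n} := by
  rintro ⟨E, hZ, hE⟩
  have h5 : Real.sqrt 5 * Real.sqrt 5 = 5 := Real.mul_self_sqrt (by norm_num)
  have h0 : 0 ≤ Real.sqrt 5 := Real.sqrt_nonneg 5
  have hlo : 2 < Real.sqrt 5 := by nlinarith
  have hhi : Real.sqrt 5 < 3 := by nlinarith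
  have hs : Real.sqrt 5 ∈ IMplus E := by
    rw [hE]
    exact ⟨1, by simp⟩
  obtain ⟨-, hsE, -, hmul⟩ := hs
  have hm : ∀ x ∈ E, Real.sqrt 5 * x ∈ E := by
    intro x hx
    have : Real.sqrt 5 * x ∈ (E : Set ℝ) := by
      rw [← hmul]
      exact ⟨x, hx, rfl⟩
    exact this
  have h2 : (2 : ℝ) ∈ E := by exact_mod_cast hZ 2
  have hinv : (2 + Real.sqrt 5)⁻¹ = Real.sqrt 5 - 2 := by
    apply inv_eq_of_mul_eq_one_right
    linarith
  have ht : 2 + Real.sqrt 5 ∈ IMplus E := by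
    refine ⟨by linarith, E.add_mem h2 hsE, ?_, ?_⟩
    · rw [hinv]
      exact E.sub_mem hsE h2
    · ext y
      constructor
      · rintro ⟨x, hx, rfl⟩
        have h := E.add_mem (E.add_mem hx hx) (hm x hx)
        have e : (2 + Real.sqrt 5) * x = x + x + Real.sqrt 5 * x := by ring
        change (2 + Real.sqrt 5) * x ∈ E
        rw [e]
        exact h
      · intro hy
        refine ⟨Real.sqrt 5 * y - (y + y), E.sub_mem (hm y hy) (E.add_mem hy hy), ?_⟩
        change (2 + Real.sqrt 5) * (Real.sqrt 5 * y - (y + y)) = y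
        linear_combination y * h5
  rw [hE] at ht
  obtain ⟨n, hn⟩ := ht
  have h1 : 1 < Real.sqrt 5 := by linarith
  have a : Real.sqrt 5 ^ (1 : ℤ) < Real.sqrt 5 ^ n := by
    rw [← hn, zpow_one]
    linarith
  have b : Real.sqrt 5 ^ n < Real.sqrt 5 ^ (2 : ℤ) := by
    rw [← hn, zpow_ofNat, pow_two, h5]
    linarith
  rw [zpow_lt_zpow_iff_right₀ h1] at a b
  omega
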